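/- arXiv:2203.13766 — 4 statements merged into one kernel-verified Lean document; each statement's English description precedes it below -/
import Mathlib

section
/- For all ξ ∈ ℝ, ω > 0 and β ∈ ℝ, the variance of the skew-normal distribution satisfies ∫_ℝ (y − (ξ + ω·δ·√(2/π)))² · (2/ω)·φ((y−ξ)/ω)·Φ(β·(y−ξ)/ω) dy = (1 − 2·δ²/π)·ω², where δ = β/√(1+β²). -/
open MeasureTheory Real

/-- Standard normal probability density function. -/
noncomputable def stdNormalPdf (x : ℝ) : ℝ :=
  (Real.sqrt (2 * Real.pi))⁻¹ * Real.exp (-x ^ 2 / 2)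

/-- Standard normal cumulative distribution function. -/
noncomputable def stdNormalCdf (x : ℝ) : ℝ :=
  ∫ u in Set.Iic x, stdNormalPdf u

theorem stdNormalPdf_neg (x : ℝ) : stdNormalPdf (-x) = stdNormalPdf x := by
  simp [stdNormalPdf]

theorem stdNormalPdf_nonneg (x : ℝ) : 0 ≤ stdNormalPdf x := by
  unfold stdNormalPdf; positivity

theorem continuous_stdNormalPdf : Continuous stdNormalPdf := by
  unfold stdNormalPdf; fun_prop

theorem integrable_pow_mul_stdNormalPdf (n : ℕ) :
    Integrable fun x : ℝ => x ^ n * stdNormalPdf x := by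
  have h := (integrable_rpow_mul_exp_neg_mul_sq (b := 1 / 2) (by norm_num)
    (s := n) (by linarith [n.cast_nonneg (α := ℝ)])).const_mul (√(2 * π))⁻¹
  refine h.congr (Filter.Eventually.of_forall fun x => ?_)
  simp only [stdNormalPdf, Real.rpow_natCast]
  rw [show -x ^ 2 / 2 = -(1 / 2) * x ^ 2 by ring]
  ring

theorem integrable_stdNormalPdf : Integrable stdNormalPdf := by
  simpa using integrable_pow_mul_stdNormalPdf 0

theorem integral_stdNormalPdf : ∫ x, stdNormalPdf x = 1 := by
  have h := integral_gaussian (1 / 2)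
  simp only [stdNormalPdf]
  rw [integral_const_mul, show (fun x : ℝ => exp (-x ^ 2 / 2)) = fun x => exp (-(1 / 2) * x ^ 2) by
    ext x; congr 1; ring, h, show π / (1 / 2) = 2 * π by ring]
  exact inv_mul_cancel₀ (by positivity)

theorem hasDerivAt_stdNormalPdf (x : ℝ) : HasDerivAt stdNormalPdf (-(x * stdNormalPdf x)) x := by
  have h : HasDerivAt (fun x : ℝ => -x ^ 2 / 2) (-x) x := by
    refine ((hasDerivAt_pow 2 x).fun_neg.div_const 2).congr_deriv ?_
    push_cast; ring
  refine (h.exp.const_mul (√(2 * π))⁻¹).congr_deriv ?_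
  rw [stdNormalPdf]; ring

theorem integral_sq_mul_stdNormalPdf : ∫ x, x ^ 2 * stdNormalPdf x = 1 := by
  have h := integral_mul_deriv_eq_deriv_mul_of_integrable (u := fun x : ℝ => x) (u' := fun _ => 1)
    (v := stdNormalPdf) (v' := fun x => -(x * stdNormalPdf x))
    (fun x _ => hasDerivAt_id x) (fun x _ => hasDerivAt_stdNormalPdf x)
    ((integrable_pow_mul_stdNormalPdf 2).neg.congr (Filter.Eventually.of_forall fun x => by
      simp only [Pi.neg_apply, Pi.mul_apply]; ring))
    (integrable_stdNormalPdf.congr (Filter.Eventually.of_forall fun x => by simp))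
    ((integrable_pow_mul_stdNormalPdf 1).congr (Filter.Eventually.of_forall fun x => by simp))
  simp only [one_mul, integral_stdNormalPdf] at h
  rw [show (fun x : ℝ => x * -(x * stdNormalPdf x)) = fun x => -(x ^ 2 * stdNormalPdf x) by
    ext x; ring, integral_neg] at h
  linarith

theorem stdNormalCdf_add_stdNormalCdf_neg (x : ℝ) : stdNormalCdf x + stdNormalCdf (-x) = 1 := by
  have h : stdNormalCdf (-x) = ∫ u in Set.Ioi x, stdNormalPdf u := by
    rw [stdNormalCdf, ← integral_comp_neg_Ioi]
    simp only [stdNormalPdf_neg]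
  rw [h, stdNormalCdf, ← integral_stdNormalPdf]
  exact intervalIntegral.integral_Iic_add_Ioi integrable_stdNormalPdf.integrableOn
    integrable_stdNormalPdf.integrableOn

theorem stdNormalCdf_nonneg (x : ℝ) : 0 ≤ stdNormalCdf x :=
  integral_nonneg stdNormalPdf_nonneg

theorem stdNormalCdf_le_one (x : ℝ) : stdNormalCdf x ≤ 1 := by
  linarith [stdNormalCdf_add_stdNormalCdf_neg x, stdNormalCdf_nonneg (-x)]

theorem hasDerivAt_stdNormalCdf (x : ℝ) : HasDerivAt stdNormalCdf (stdNormalPdf x) x := by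
  have h : stdNormalCdf = fun y => stdNormalCdf 0 + ∫ u in (0 : ℝ)..y, stdNormalPdf u := by
    ext y
    rw [← intervalIntegral.integral_Iic_sub_Iic integrable_stdNormalPdf.integrableOn
      integrable_stdNormalPdf.integrableOn]
    simp [stdNormalCdf]
  rw [h]
  exact (intervalIntegral.integral_hasDerivAt_right (continuous_stdNormalPdf.intervalIntegrable _ _)
    continuous_stdNormalPdf.aestronglyMeasurable.stronglyMeasurableAtFilter
    continuous_stdNormalPdf.continuousAt).const_add _

theorem continuous_stdNormalCdf : Continuous stdNormalCdf :=
  continuous_iff_continuousAt.2 fun x => (hasDerivAt_stdNormalCdf x).continuousAt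

theorem MeasureTheory.Integrable.mul_stdNormalCdf {g : ℝ → ℝ} (hg : Integrable g) (β : ℝ) :
    Integrable fun x => g x * stdNormalCdf (β * x) := by
  refine hg.mul_bdd (c := 1) (continuous_stdNormalCdf.comp
    (continuous_const.mul continuous_id)).aestronglyMeasurable
    (Filter.Eventually.of_forall fun x => ?_)
  rw [Real.norm_eq_abs, abs_of_nonneg (stdNormalCdf_nonneg _)]
  exact stdNormalCdf_le_one _

theorem integral_mul_stdNormalCdf_of_even {g : ℝ → ℝ} (hg : Integrable g)
    (heven : ∀ x, g (-x) = g x) (β : ℝ) :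
    ∫ x, g x * stdNormalCdf (β * x) = (∫ x, g x) / 2 := by
  have hi := hg.mul_stdNormalCdf β
  have h : ∫ x, g x * stdNormalCdf (β * x) = ∫ x, (g x - g x * stdNormalCdf (β * x)) := by
    rw [← integral_neg_eq_self]
    refine integral_congr_ae (Filter.Eventually.of_forall fun x => ?_)
    have := stdNormalCdf_add_stdNormalCdf_neg (β * x)
    simp only [heven, mul_neg]
    linear_combination g x * this
  rw [integral_sub hg hi] at h
  linarith

theorem integral_stdNormalPdf_mul_stdNormalPdf (β : ℝ) :
    ∫ x, stdNormalPdf x * stdNormalPdf (β * x) = (√(2 * π))⁻¹ * (√(1 + β ^ 2))⁻¹ := by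
  have hs : 0 < √(1 + β ^ 2) := by positivity
  have h (x : ℝ) : stdNormalPdf x * stdNormalPdf (β * x) =
      (√(2 * π))⁻¹ * stdNormalPdf (√(1 + β ^ 2) * x) := by
    simp only [stdNormalPdf, mul_pow, Real.sq_sqrt (show 0 ≤ 1 + β ^ 2 by positivity)]
    rw [mul_mul_mul_comm, ← Real.exp_add, mul_assoc]
    ring_nf
  simp only [h]
  rw [integral_const_mul, Measure.integral_comp_mul_left, integral_stdNormalPdf,
    abs_of_pos (by positivity)]
  simp

theorem integral_mul_stdNormalPdf_mul_stdNormalCdf (β : ℝ) :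
    ∫ x, x * stdNormalPdf x * stdNormalCdf (β * x) =
      β * ((√(2 * π))⁻¹ * (√(1 + β ^ 2))⁻¹) := by
  have hΦ (x : ℝ) : HasDerivAt (fun x => stdNormalCdf (β * x)) (stdNormalPdf (β * x) * β) x := by
    simpa [Function.comp_def] using
      (hasDerivAt_stdNormalCdf (β * x)).comp x ((hasDerivAt_id x).const_mul β)
  have hx : Integrable fun x => x * stdNormalPdf x := by
    simpa using integrable_pow_mul_stdNormalPdf 1
  have hφ : Integrable fun x => stdNormalPdf x * stdNormalPdf (β * x) := by
    refine integrable_stdNormalPdf.mul_bdd (c := (√(2 * π))⁻¹) (continuous_stdNormalPdf.comp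
      (continuous_const.mul continuous_id)).aestronglyMeasurable
      (Filter.Eventually.of_forall fun x => ?_)
    rw [Real.norm_eq_abs, abs_of_nonneg (stdNormalPdf_nonneg _)]
    refine mul_le_of_le_one_right (by positivity) (Real.exp_le_one_iff.2 ?_)
    have := sq_nonneg (β * x)
    linarith
  have h := integral_mul_deriv_eq_deriv_mul_of_integrable (v := stdNormalPdf)
    (v' := fun x => -(x * stdNormalPdf x))
    (fun x _ => hΦ x) (fun x _ => hasDerivAt_stdNormalPdf x)
    ((hx.mul_stdNormalCdf β).neg.congr (Filter.Eventually.of_forall fun x => by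
      simp only [Pi.neg_apply, Pi.mul_apply]; ring))
    ((hφ.const_mul β).congr (Filter.Eventually.of_forall fun x => by
      simp only [Pi.mul_apply]; ring))
    ((integrable_stdNormalPdf.mul_stdNormalCdf β).congr (Filter.Eventually.of_forall fun x => by
      simp only [Pi.mul_apply]; ring))
  rw [show (fun x => stdNormalCdf (β * x) * -(x * stdNormalPdf x)) =
      fun x => -(x * stdNormalPdf x * stdNormalCdf (β * x)) by ext x; ring,
    show (fun x => stdNormalPdf (β * x) * β * stdNormalPdf x) =
      fun x => β * (stdNormalPdf x * stdNormalPdf (β * x)) by ext x; ring,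
    integral_neg, integral_const_mul, integral_stdNormalPdf_mul_stdNormalPdf] at h
  linarith

theorem integral_sub_sq_mul_stdNormalPdf_mul_stdNormalCdf (β m : ℝ) :
    ∫ z, (z - m) ^ 2 * (2 * stdNormalPdf z * stdNormalCdf (β * z)) =
      1 - 4 * m * (β * ((√(2 * π))⁻¹ * (√(1 + β ^ 2))⁻¹)) + m ^ 2 := by
  have i2 := (integrable_pow_mul_stdNormalPdf 2).mul_stdNormalCdf β
  have i1 := (integrable_pow_mul_stdNormalPdf 1).mul_stdNormalCdf β
  have i0 := integrable_stdNormalPdf.mul_stdNormalCdf β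
  simp only [pow_one] at i1
  rw [show (fun z => (z - m) ^ 2 * (2 * stdNormalPdf z * stdNormalCdf (β * z))) = fun z =>
      2 * (z ^ 2 * stdNormalPdf z * stdNormalCdf (β * z)) -
        4 * m * (z * stdNormalPdf z * stdNormalCdf (β * z)) +
        2 * m ^ 2 * (stdNormalPdf z * stdNormalCdf (β * z)) by ext z; ring,
    integral_add (by exact (i2.const_mul _).sub (i1.const_mul _)) (i0.const_mul _),
    integral_sub (i2.const_mul _) (i1.const_mul _), integral_const_mul, integral_const_mul,
    integral_const_mul, integral_mul_stdNormalPdf_mul_stdNormalCdf,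
    integral_mul_stdNormalCdf_of_even integrable_stdNormalPdf stdNormalPdf_neg,
    integral_mul_stdNormalCdf_of_even (integrable_pow_mul_stdNormalPdf 2)
      (fun x => by simp [stdNormalPdf_neg]),
    integral_stdNormalPdf, integral_sq_mul_stdNormalPdf]
  ring

/-- Variance of the skew-normal distribution `SN(ξ, ω², β)`:
`∫ (y − (ξ + ωδ√(2/π)))² · (2/ω) φ((y−ξ)/ω) Φ(β(y−ξ)/ω) dy = (1 − 2δ²/π) ω²`
with `δ = β/√(1+β²)`. -/
theorem skewNormal_variance (ξ ω β : ℝ) (hω : 0 < ω) :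
    (∫ y : ℝ, (y - (ξ + ω * (β / Real.sqrt (1 + β ^ 2)) * Real.sqrt (2 / Real.pi))) ^ 2 *
        ((2 / ω) * stdNormalPdf ((y - ξ) / ω) * stdNormalCdf (β * ((y - ξ) / ω)))) =
      (1 - 2 * (β / Real.sqrt (1 + β ^ 2)) ^ 2 / Real.pi) * ω ^ 2 := by
  set m := β / √(1 + β ^ 2) * √(2 / π) with hm
  have hscale (y : ℝ) : (y - (ξ + ω * (β / √(1 + β ^ 2)) * √(2 / π))) ^ 2 *
      ((2 / ω) * stdNormalPdf ((y - ξ) / ω) * stdNormalCdf (β * ((y - ξ) / ω))) =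
      ω * (fun z => (z - m) ^ 2 * (2 * stdNormalPdf z * stdNormalCdf (β * z))) ((y - ξ) / ω) := by
    have : y - (ξ + ω * (β / √(1 + β ^ 2)) * √(2 / π)) = ω * ((y - ξ) / ω - m) := by
      rw [hm]; field_simp; ring
    rw [this]
    field_simp
  simp only [hscale]
  rw [integral_const_mul,
    integral_sub_right_eq_self (fun y => (y / ω - m) ^ 2 *
      (2 * stdNormalPdf (y / ω) * stdNormalCdf (β * (y / ω)))) ξ,
    Measure.integral_comp_div (fun z => (z - m) ^ 2 *
      (2 * stdNormalPdf z * stdNormalCdf (β * z))) ω,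
    integral_sub_sq_mul_stdNormalPdf_mul_stdNormalCdf, abs_of_pos hω, smul_eq_mul]
  have h2 : √(2 / π) = 2 * (√(2 * π))⁻¹ := by
    rw [← Real.sqrt_inv, show (2 : ℝ) / π = 2 ^ 2 * (2 * π)⁻¹ by field_simp,
      Real.sqrt_mul (by positivity), Real.sqrt_sq (by norm_num)]
  have hsq : (√(2 * π))⁻¹ ^ 2 = (2 * π)⁻¹ := by
    rw [inv_pow, Real.sq_sqrt (by positivity)]
  have hpi : (2 * π)⁻¹ = 1 / 2 * (1 / π) := by field_simp
  rw [hm, h2]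
  rw [hpi] at hsq
  linear_combination (-4 * ω ^ 2 * (β / √(1 + β ^ 2)) ^ 2) * hsq
end

section
/- (Sum of an independent skew-normal and normal random variable, stated at the level of densities.) For all ξ, μ ∈ ℝ, ω > 0, σ > 0, β ∈ ℝ and every z ∈ ℝ, the convolution of the SN(ξ, ω², β) density with the N(μ, σ²) density equals the SN(ξ+μ, ω²+σ², β̃) density evaluated at z, where β̃ = β/√(1 + (1+β²)·σ²/ω²); that is, ∫_ℝ (2/ω)·φ((z−t−ξ)/ω)·Φ(β·(z−t−ξ)/ω) · (1/σ)·φ((t−μ)/σ) dt = (2/√(ω²+σ²))·φ((z−ξ−μ)/√(ω²+σ²))·Φ(β̃·(z−ξ−μ)/√(ω²+σ²)). -/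
open MeasureTheory Real

open ProbabilityTheory

lemma stdNormalPdf_eq_gaussianPDFReal (x : ℝ) : stdNormalPdf x = gaussianPDFReal 0 1 x := by
  simp [stdNormalPdf, gaussianPDFReal]

lemma stdNormalCdf_eq_gaussianReal (x : ℝ) :
    stdNormalCdf x = (gaussianReal 0 1).real (Set.Iic x) := by
  have h : (0 : ℝ) ≤ ∫ u in Set.Iic x, gaussianPDFReal 0 1 u :=
    integral_nonneg fun u => gaussianPDFReal_nonneg 0 1 u
  rw [Measure.real, gaussianReal_apply_eq_integral 0 one_ne_zero, ENNReal.toReal_ofReal h]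
  simp only [stdNormalCdf, stdNormalPdf_eq_gaussianPDFReal]

lemma gaussianReal_real_Iic (a b : ℝ) :
    (gaussianReal 0 (NNReal.mk (b ^ 2) (sq_nonneg b) + 1)).real (Set.Iic a) =
      stdNormalCdf (a / √(1 + b ^ 2)) := by
  have hr : 0 < √(1 + b ^ 2) := by positivity
  have h := gaussianReal_map_const_mul (μ := 0) (v := 1) (√(1 + b ^ 2))
  have hv : NNReal.mk (√(1 + b ^ 2) ^ 2) (sq_nonneg _) * 1 =
      NNReal.mk (b ^ 2) (sq_nonneg b) + 1 := by
    ext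
    have := Real.sq_sqrt (show 0 ≤ 1 + b ^ 2 by positivity)
    simp only [mul_one, NNReal.coe_mk, NNReal.coe_add, NNReal.coe_one, this]
    ring
  rw [hv, mul_zero] at h
  rw [← h, map_measureReal_apply (by fun_prop) measurableSet_Iic, stdNormalCdf_eq_gaussianReal]
  congr 1
  ext x
  simp [le_div_iff₀ hr, mul_comm]

lemma integral_stdNormalPdf_mul_stdNormalCdf (a b : ℝ) :
    ∫ x, stdNormalPdf x * stdNormalCdf (a + b * x) = stdNormalCdf (a / √(1 + b ^ 2)) := by
  have hmap := gaussianReal_map_const_mul (μ := 0) (v := 1) (-b)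
  have hconv := gaussianReal_conv_gaussianReal (m₁ := 0) (m₂ := 0)
    (v₁ := .mk (b ^ 2) (sq_nonneg b)) (v₂ := 1)
  have hv : NNReal.mk ((-b) ^ 2) (sq_nonneg _) * 1 = NNReal.mk (b ^ 2) (sq_nonneg b) := by
    ext; simp
  rw [hv, mul_zero] at hmap
  rw [add_zero] at hconv
  have hmeas : Measurable fun y : ℝ => gaussianReal 0 1 (Set.Iic y) :=
    Monotone.measurable fun x y h => measure_mono (Set.Iic_subset_Iic.2 h)
  have key : gaussianReal 0 (NNReal.mk (b ^ 2) (sq_nonneg b) + 1) (Set.Iic a) =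
      ∫⁻ x, gaussianReal 0 1 (Set.Iic (a + b * x)) ∂gaussianReal 0 1 := by
    rw [← hconv, ← lintegral_indicator_one measurableSet_Iic, Measure.lintegral_conv
      (measurable_one.indicator measurableSet_Iic), ← hmap, lintegral_map ?_ (by fun_prop)]
    · refine lintegral_congr fun x => ?_
      rw [← lintegral_indicator_one measurableSet_Iic]
      refine lintegral_congr fun y => ?_
      simp only [Set.indicator_apply, Set.mem_Iic]
      congr 1
      apply propext
      constructor <;> intro h <;> linarith
    · exact Measurable.lintegral_prod_right' (f := fun p : ℝ × ℝ =>
        (Set.Iic a).indicator 1 (p.1 + p.2))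
        ((measurable_one.indicator measurableSet_Iic).comp measurable_add)
  have hmeas' : Measurable fun x : ℝ => gaussianReal 0 1 (Set.Iic (a + b * x)) :=
    hmeas.comp (by fun_prop)
  rw [← gaussianReal_real_Iic, Measure.real, key, ← integral_toReal
    hmeas'.aemeasurable (ae_of_all _ fun x => measure_lt_top _ _),
    integral_gaussianReal_eq_integral_smul one_ne_zero]
  simp only [stdNormalPdf_eq_gaussianPDFReal, stdNormalCdf_eq_gaussianReal, Measure.real,
    smul_eq_mul]

lemma stdNormalPdf_mul_stdNormalPdf {p q r s : ℝ} (h : p ^ 2 + q ^ 2 = r ^ 2 + s ^ 2) :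
    stdNormalPdf p * stdNormalPdf q = stdNormalPdf r * stdNormalPdf s := by
  simp only [stdNormalPdf]
  rw [mul_mul_mul_comm, mul_mul_mul_comm _ (rexp (-r ^ 2 / 2)), ← Real.exp_add, ← Real.exp_add]
  congr 2
  linarith

lemma integral_eq_mul_integral_comp_affine (g : ℝ → ℝ) {s : ℝ} (hs : 0 < s) (c : ℝ) :
    ∫ t, g t = s * ∫ x, g (s * x + c) := by
  rw [Measure.integral_comp_mul_left (fun x => g (x + c)) s, integral_add_right_eq_self,
    abs_of_pos (inv_pos.2 hs), smul_eq_mul, mul_inv_cancel_left₀ hs.ne']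

/-- The convolution of a skew-normal `SN(ξ, ω², β)` density with an independent
normal `N(μ, σ²)` density is the skew-normal `SN(ξ+μ, ω²+σ², β̃)` density, where
`β̃ = β/√(1 + (1+β²) σ²/ω²)`. -/
theorem skewNormal_add_normal_density (ξ μ ω σ β : ℝ) (hω : 0 < ω) (hσ : 0 < σ) (z : ℝ) :
    (∫ t : ℝ,
        ((2 / ω) * stdNormalPdf ((z - t - ξ) / ω) * stdNormalCdf (β * ((z - t - ξ) / ω))) *
          ((1 / σ) * stdNormalPdf ((t - μ) / σ))) =
      (2 / Real.sqrt (ω ^ 2 + σ ^ 2)) *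
        stdNormalPdf ((z - ξ - μ) / Real.sqrt (ω ^ 2 + σ ^ 2)) *
        stdNormalCdf ((β / Real.sqrt (1 + (1 + β ^ 2) * σ ^ 2 / ω ^ 2)) *
          ((z - ξ - μ) / Real.sqrt (ω ^ 2 + σ ^ 2))) := by
  set τ := √(ω ^ 2 + σ ^ 2) with hτ_def
  have hτ : 0 < τ := by positivity
  have hτ2 : τ ^ 2 = ω ^ 2 + σ ^ 2 := Real.sq_sqrt (by positivity)
  rw [integral_eq_mul_integral_comp_affine _ (show 0 < ω * σ / τ by positivity)
    (μ + (z - ξ - μ) * σ ^ 2 / τ ^ 2)]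
  obtain ⟨w, rfl⟩ : ∃ w, z = w + ξ + μ := ⟨z - ξ - μ, by ring⟩
  have hw : w + ξ + μ - ξ - μ = w := by ring
  rw [hw]
  have hintegrand (x : ℝ) :
      ((2 / ω) * stdNormalPdf ((w + ξ + μ - (ω * σ / τ * x + (μ + w * σ ^ 2 / τ ^ 2)) - ξ) / ω) *
        stdNormalCdf (β * ((w + ξ + μ - (ω * σ / τ * x + (μ + w * σ ^ 2 / τ ^ 2)) - ξ) / ω))) *
          ((1 / σ) * stdNormalPdf ((ω * σ / τ * x + (μ + w * σ ^ 2 / τ ^ 2) - μ) / σ)) =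
      (2 / (ω * σ) * stdNormalPdf (w / τ)) *
        (stdNormalPdf x * stdNormalCdf (β * w * ω / τ ^ 2 + -(β * σ / τ) * x)) := by
    have h₁ : (w + ξ + μ - (ω * σ / τ * x + (μ + w * σ ^ 2 / τ ^ 2)) - ξ) / ω =
        w * ω / τ ^ 2 - σ / τ * x := by
      field_simp
      linear_combination w * hτ2
    have h₂ : (ω * σ / τ * x + (μ + w * σ ^ 2 / τ ^ 2) - μ) / σ =
        w * σ / τ ^ 2 + ω / τ * x := by
      field_simp
      ring
    have h₃ : (w * ω / τ ^ 2 - σ / τ * x) ^ 2 + (w * σ / τ ^ 2 + ω / τ * x) ^ 2 =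
        (w / τ) ^ 2 + x ^ 2 := by
      field_simp
      linear_combination (-(w ^ 2 + τ ^ 2 * x ^ 2)) * hτ2
    have h₄ : β * (w * ω / τ ^ 2 - σ / τ * x) =
        β * w * ω / τ ^ 2 + -(β * σ / τ) * x := by ring
    rw [h₁, h₂, h₄]
    linear_combination (2 / (ω * σ) * stdNormalCdf (β * w * ω / τ ^ 2 + -(β * σ / τ) * x)) *
      stdNormalPdf_mul_stdNormalPdf h₃
  simp only [hintegrand]
  rw [integral_const_mul, integral_stdNormalPdf_mul_stdNormalCdf]
  have hsqrt : √(1 + (1 + β ^ 2) * σ ^ 2 / ω ^ 2) = √(1 + (-(β * σ / τ)) ^ 2) * (τ / ω) := by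
    rw [← Real.sqrt_sq (show 0 ≤ τ / ω by positivity), ← Real.sqrt_mul (by positivity)]
    congr 1
    field_simp
    linear_combination -hτ2
  have harg : β * w * ω / τ ^ 2 / √(1 + (-(β * σ / τ)) ^ 2) =
      β / √(1 + (1 + β ^ 2) * σ ^ 2 / ω ^ 2) * (w / τ) := by
    have : 0 < √(1 + (-(β * σ / τ)) ^ 2) := by positivity
    rw [hsqrt]
    field_simp
  rw [harg]
  field_simp
end

section
/- (Distributional part of Proposition 2.3 of the paper, at the level of densities.) Let t > 0, β_B ∈ ℝ, ρ ∈ (0, 1), and set δ_B = β_B/√(1+β_B²) and β_i = β_B/√(1 + (1+β_B²)·(1 − 2δ_B²/π)·(1/ρ² − 1)). Then for every z ∈ ℝ, the convolution of the SN(0, ρ²t, β_B) density with the N(0, (1 − 2δ_B²/π)·(1 − ρ²)·t) density, evaluated at z, equals the SN(0, ρ²t + (1 − 2δ_B²/π)·(1 − ρ²)·t, β_i) density evaluated at z. -/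
open MeasureTheory Real

open ProbabilityTheory

lemma gaussianPDFReal_eq_stdNormalPdf (x : ℝ) :
    gaussianPDFReal 0 1 x = stdNormalPdf x := by
  simp [gaussianPDFReal, stdNormalPdf]

lemma integral_stdNormalCdf_affine (p q : ℝ) :
    ∫ x, stdNormalPdf x * stdNormalCdf (p + q * x) = stdNormalCdf (p / √(1 + q ^ 2)) := by
  have hc : 0 < √(1 + q ^ 2) := by positivity
  have hlaw : ((gaussianReal 0 1).map (fun x => -q * x)) ∗ gaussianReal 0 1 =
      (gaussianReal 0 1).map (fun x => √(1 + q ^ 2) * x) := by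
    rw [gaussianReal_map_const_mul, gaussianReal_map_const_mul, gaussianReal_conv_gaussianReal]
    congr 1
    · simp
    · ext
      simp [Real.sq_sqrt (show 0 ≤ 1 + q ^ 2 by positivity)]
      ring
  have h := congrArg (fun μ => μ (Set.Iic p)) hlaw
  rw [Measure.conv, Measure.map_apply (by fun_prop) measurableSet_Iic,
    Measure.prod_apply (measurableSet_Iic.preimage (by fun_prop)),
    Measure.map_apply (by fun_prop) measurableSet_Iic,
    lintegral_map (measurable_measure_prodMk_left (measurableSet_Iic.preimage (by fun_prop)))
      (by fun_prop)] at h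
  have h1 (x : ℝ) : Prod.mk (-q * x) ⁻¹' ((fun y : ℝ × ℝ => y.1 + y.2) ⁻¹' Set.Iic p) =
      Set.Iic (p + q * x) := by
    ext y
    simp only [Set.mem_preimage, Set.mem_Iic]
    constructor <;> intro h <;> linarith
  have h2 : (fun x => √(1 + q ^ 2) * x) ⁻¹' Set.Iic p = Set.Iic (p / √(1 + q ^ 2)) := by
    ext y
    simp only [Set.mem_preimage, Set.mem_Iic]
    rw [le_div_iff₀ hc, mul_comm]
  simp only [h1, h2] at h
  rw [stdNormalCdf_eq_gaussianReal (p / _), measureReal_def, ← h, ← integral_toReal]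
  · rw [integral_gaussianReal_eq_integral_smul one_ne_zero]
    simp only [gaussianPDFReal_eq_stdNormalPdf, stdNormalCdf_eq_gaussianReal, measureReal_def,
      smul_eq_mul]
  · have hm : Measurable fun y : ℝ => gaussianReal 0 1 (Set.Iic y) :=
      Monotone.measurable fun a b hab => measure_mono (Set.Iic_subset_Iic.2 hab)
    exact (hm.comp (by fun_prop : Measurable fun x : ℝ => p + q * x)).aemeasurable
  · exact Filter.Eventually.of_forall fun x => measure_lt_top _ _

lemma stdNormalPdf_mul_of_sq_add_sq {a b c d : ℝ} (h : a ^ 2 + b ^ 2 = c ^ 2 + d ^ 2) :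
    stdNormalPdf a * stdNormalPdf b = stdNormalPdf c * stdNormalPdf d := by
  simp only [stdNormalPdf]
  rw [mul_mul_mul_comm, mul_mul_mul_comm _ (rexp (-c ^ 2 / 2)), ← Real.exp_add, ← Real.exp_add]
  congr 2
  linarith

/-- The convolution of a centred skew-normal density with a centred normal density. -/
lemma integral_skewNormal_mul_normal {a b s : ℝ} (ha : 0 < a) (hb : 0 < b) (hs : 0 < s)
    (h : s ^ 2 = a ^ 2 + b ^ 2) (β z : ℝ) :
    (∫ u : ℝ, ((2 / a) * stdNormalPdf ((z - u) / a) * stdNormalCdf (β * ((z - u) / a))) *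
        ((1 / b) * stdNormalPdf (u / b))) =
      (2 / s) * stdNormalPdf (z / s) *
        stdNormalCdf (β / √(1 + (1 + β ^ 2) * (b ^ 2 / a ^ 2)) * (z / s)) := by
  set σ := a * b / s with hσ
  have hσ0 : 0 < σ := by positivity
  set F : ℝ → ℝ := fun u =>
    ((2 / a) * stdNormalPdf ((z - u) / a) * stdNormalCdf (β * ((z - u) / a))) *
        ((1 / b) * stdNormalPdf (u / b)) with hF
  have hsub : ∫ u, F u = σ * ∫ x, F (σ * x + z * b ^ 2 / s ^ 2) := by
    rw [Measure.integral_comp_mul_left (fun y => F (y + z * b ^ 2 / s ^ 2)) σ,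
      integral_add_right_eq_self F, abs_of_pos (inv_pos.2 hσ0), smul_eq_mul,
      mul_inv_cancel_left₀ hσ0.ne']
  have hpt (x : ℝ) : F (σ * x + z * b ^ 2 / s ^ 2) =
      (2 / (a * b) * stdNormalPdf (z / s)) *
        (stdNormalPdf x * stdNormalCdf (β * z * a / s ^ 2 + (-(β * b / s)) * x)) := by
    have e1 : (z - (σ * x + z * b ^ 2 / s ^ 2)) / a = z * a / s ^ 2 - b * x / s := by
      rw [hσ]
      field_simp
      rw [h]
      ring
    have e2 : (σ * x + z * b ^ 2 / s ^ 2) / b = z * b / s ^ 2 + a * x / s := by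
      rw [hσ]
      field_simp
      ring
    have e3 := stdNormalPdf_mul_of_sq_add_sq
      (a := z * a / s ^ 2 - b * x / s) (b := z * b / s ^ 2 + a * x / s) (c := z / s) (d := x) (by
        have : (z * a / s ^ 2 - b * x / s) ^ 2 + (z * b / s ^ 2 + a * x / s) ^ 2 =
            (z ^ 2 / s ^ 4 + x ^ 2 / s ^ 2) * (a ^ 2 + b ^ 2) := by
          field_simp
          ring
        rw [this, ← h]
        field_simp)
    have e4 : β * (z * a / s ^ 2 - b * x / s) = β * z * a / s ^ 2 + (-(β * b / s)) * x := by ring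
    simp only [hF, e1, e2, e4]
    linear_combination (2 / (a * b) *
      stdNormalCdf (β * z * a / s ^ 2 + (-(β * b / s)) * x)) * e3
  rw [hsub]
  simp only [hpt]
  rw [integral_const_mul, integral_stdNormalCdf_affine]
  have e5 : √(1 + (1 + β ^ 2) * (b ^ 2 / a ^ 2)) = s / a * √(1 + (-(β * b / s)) ^ 2) := by
    rw [← Real.sqrt_sq (show 0 ≤ s / a by positivity), ← Real.sqrt_mul (by positivity)]
    congr 1
    field_simp
    rw [h]
    ring
  have hr : 0 < √(1 + (-(β * b / s)) ^ 2) := by positivity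
  rw [e5]
  have e6 : β * z * a / s ^ 2 / √(1 + (-(β * b / s)) ^ 2) =
      β / (s / a * √(1 + (-(β * b / s)) ^ 2)) * (z / s) := by
    field_simp
  rw [e6, hσ]
  field_simp

/-- Distributional part of Proposition 2.3: the convolution of the `SN(0, ρ²t, β_B)`
density with the `N(0, (1 − 2δ_B²/π)(1 − ρ²)t)` density is the
`SN(0, ρ²t + (1 − 2δ_B²/π)(1 − ρ²)t, β_i)` density, where `δ_B = β_B/√(1+β_B²)` and
`β_i = β_B/√(1 + (1+β_B²)(1 − 2δ_B²/π)(1/ρ² − 1))`. -/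
theorem skewABM_asset_density (t β_B ρ : ℝ) (ht : 0 < t) (hρ : ρ ∈ Set.Ioo (0 : ℝ) 1)
    (z : ℝ) :
    (∫ u : ℝ,
        ((2 / Real.sqrt (ρ ^ 2 * t)) * stdNormalPdf ((z - u) / Real.sqrt (ρ ^ 2 * t)) *
            stdNormalCdf (β_B * ((z - u) / Real.sqrt (ρ ^ 2 * t)))) *
          ((1 / Real.sqrt ((1 - 2 * (β_B / Real.sqrt (1 + β_B ^ 2)) ^ 2 / Real.pi) *
              (1 - ρ ^ 2) * t)) *
            stdNormalPdf (u / Real.sqrt ((1 - 2 * (β_B / Real.sqrt (1 + β_B ^ 2)) ^ 2 / Real.pi) *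
              (1 - ρ ^ 2) * t)))) =
      (2 / Real.sqrt (ρ ^ 2 * t +
          (1 - 2 * (β_B / Real.sqrt (1 + β_B ^ 2)) ^ 2 / Real.pi) * (1 - ρ ^ 2) * t)) *
        stdNormalPdf (z / Real.sqrt (ρ ^ 2 * t +
          (1 - 2 * (β_B / Real.sqrt (1 + β_B ^ 2)) ^ 2 / Real.pi) * (1 - ρ ^ 2) * t)) *
        stdNormalCdf ((β_B / Real.sqrt (1 + (1 + β_B ^ 2) *
            (1 - 2 * (β_B / Real.sqrt (1 + β_B ^ 2)) ^ 2 / Real.pi) * (1 / ρ ^ 2 - 1))) *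
          (z / Real.sqrt (ρ ^ 2 * t +
            (1 - 2 * (β_B / Real.sqrt (1 + β_B ^ 2)) ^ 2 / Real.pi) * (1 - ρ ^ 2) * t))) := by
  obtain ⟨hρ0, hρ1⟩ := hρ
  have hδ : (β_B / √(1 + β_B ^ 2)) ^ 2 ≤ 1 := by
    rw [div_pow, Real.sq_sqrt (by positivity)]
    exact div_le_one_of_le₀ (by linarith) (by positivity)
  set κ := 1 - 2 * (β_B / √(1 + β_B ^ 2)) ^ 2 / π with hκ
  have hκ0 : 0 < κ := by
    rw [hκ, sub_pos, div_lt_one Real.pi_pos]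
    linarith [Real.pi_gt_three]
  have hA : 0 < ρ ^ 2 * t := by positivity
  have hB : 0 < κ * (1 - ρ ^ 2) * t := by
    have : 0 < 1 - ρ ^ 2 := by nlinarith
    positivity
  have key := integral_skewNormal_mul_normal (Real.sqrt_pos.2 hA) (Real.sqrt_pos.2 hB)
    (Real.sqrt_pos.2 (add_pos hA hB))
    (by rw [Real.sq_sqrt hA.le, Real.sq_sqrt hB.le, Real.sq_sqrt (add_pos hA hB).le]) β_B z
  rw [key, Real.sq_sqrt hA.le, Real.sq_sqrt hB.le]
  have e : (1 + β_B ^ 2) * (κ * (1 - ρ ^ 2) * t / (ρ ^ 2 * t)) =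
      (1 + β_B ^ 2) * κ * (1 / ρ ^ 2 - 1) := by
    field_simp
  rw [e]
end

section
/- Let σ_B > 0, σ_i > 0 and ρ ∈ (0, 1], set S = √((σ_B² − σ_i²)² + 4ρ²σ_B²σ_i²), λ₁ = (1/2)(σ_B² + σ_i² + S) and λ₂ = (1/2)(σ_B² + σ_i² − S), and define C₁ = ρ·σ_B·σ_i·(λ₁ − σ_B²)·λ₁ / (ρ²σ_B²σ_i² + (λ₁ − σ_B²)²) and C₂ = ρ·σ_B·σ_i·(λ₂ − σ_B²)·λ₂ / (ρ²σ_B²σ_i² + (λ₂ − σ_B²)²). Then C₁ ≥ 0 and C₂ ≤ 0. -/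
/-- Signs of the two covariance contributions in the benchmark–asset principal
component factorization: with `S = √((σ_B² − σ_i²)² + 4ρ²σ_B²σ_i²)`,
`λ₁ = (σ_B² + σ_i² + S)/2`, `λ₂ = (σ_B² + σ_i² − S)/2`,
`C₁ = ρσ_Bσ_i(λ₁ − σ_B²)λ₁/(ρ²σ_B²σ_i² + (λ₁ − σ_B²)²) ≥ 0` and
`C₂ = ρσ_Bσ_i(λ₂ − σ_B²)λ₂/(ρ²σ_B²σ_i² + (λ₂ − σ_B²)²) ≤ 0`. -/
theorem covariance_contribution_signs (σ_B σ_i ρ : ℝ) (hB : 0 < σ_B) (hi : 0 < σ_i)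
    (hρ : ρ ∈ Set.Ioc (0 : ℝ) 1) :
    0 ≤ ρ * σ_B * σ_i *
        ((1 / 2) * (σ_B ^ 2 + σ_i ^ 2 +
            Real.sqrt ((σ_B ^ 2 - σ_i ^ 2) ^ 2 + 4 * ρ ^ 2 * σ_B ^ 2 * σ_i ^ 2)) - σ_B ^ 2) *
        ((1 / 2) * (σ_B ^ 2 + σ_i ^ 2 +
            Real.sqrt ((σ_B ^ 2 - σ_i ^ 2) ^ 2 + 4 * ρ ^ 2 * σ_B ^ 2 * σ_i ^ 2))) /
        (ρ ^ 2 * σ_B ^ 2 * σ_i ^ 2 +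
          ((1 / 2) * (σ_B ^ 2 + σ_i ^ 2 +
              Real.sqrt ((σ_B ^ 2 - σ_i ^ 2) ^ 2 + 4 * ρ ^ 2 * σ_B ^ 2 * σ_i ^ 2)) -
            σ_B ^ 2) ^ 2) ∧
    ρ * σ_B * σ_i *
        ((1 / 2) * (σ_B ^ 2 + σ_i ^ 2 -
            Real.sqrt ((σ_B ^ 2 - σ_i ^ 2) ^ 2 + 4 * ρ ^ 2 * σ_B ^ 2 * σ_i ^ 2)) - σ_B ^ 2) *
        ((1 / 2) * (σ_B ^ 2 + σ_i ^ 2 -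
            Real.sqrt ((σ_B ^ 2 - σ_i ^ 2) ^ 2 + 4 * ρ ^ 2 * σ_B ^ 2 * σ_i ^ 2))) /
        (ρ ^ 2 * σ_B ^ 2 * σ_i ^ 2 +
          ((1 / 2) * (σ_B ^ 2 + σ_i ^ 2 -
              Real.sqrt ((σ_B ^ 2 - σ_i ^ 2) ^ 2 + 4 * ρ ^ 2 * σ_B ^ 2 * σ_i ^ 2)) -
            σ_B ^ 2) ^ 2) ≤ 0 := by
  obtain ⟨hρ0, hρ1⟩ := hρ
  have hS_lower : |σ_B ^ 2 - σ_i ^ 2| ≤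
      √((σ_B ^ 2 - σ_i ^ 2) ^ 2 + 4 * ρ ^ 2 * σ_B ^ 2 * σ_i ^ 2) :=
    Real.abs_le_sqrt (le_add_of_nonneg_right (by positivity))
  have hS_upper : √((σ_B ^ 2 - σ_i ^ 2) ^ 2 + 4 * ρ ^ 2 * σ_B ^ 2 * σ_i ^ 2) ≤
      σ_B ^ 2 + σ_i ^ 2 := by
    refine Real.sqrt_le_iff.mpr ⟨by positivity, ?_⟩
    have hρ_sq : ρ ^ 2 ≤ 1 := pow_le_one₀ hρ0.le hρ1
    have h := mul_le_mul_of_nonneg_right hρ_sq (by positivity : 0 ≤ σ_B ^ 2 * σ_i ^ 2)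
    linarith
  generalize √((σ_B ^ 2 - σ_i ^ 2) ^ 2 + 4 * ρ ^ 2 * σ_B ^ 2 * σ_i ^ 2) = S at *
  obtain ⟨h_neg, h_pos⟩ := abs_le.mp hS_lower
  have hcov : 0 ≤ ρ * σ_B * σ_i := by positivity
  constructor
  · refine div_nonneg (mul_nonneg (mul_nonneg hcov ?_) ?_) (by positivity)
    · linarith
    · linarith [sq_nonneg σ_B]
  · refine div_nonpos_of_nonpos_of_nonneg
      (mul_nonpos_of_nonpos_of_nonneg (mul_nonpos_of_nonneg_of_nonpos hcov ?_) ?_)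
      (by positivity) <;> linarith
end
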